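/- Let h : ℕ → ℝ satisfy h(j) ≥ 1 for all j ≥ 1 and Σ_{j≥1} 1/h(j) ≤ 1. Let k : ℕ → ℕ be nondecreasing and let n₀ ≥ 2 be an integer such that k(⌊log₂ n⌋) ≤ n/2 for all n ≥ n₀. For each j ≥ 1 let Ẑ_j be an F_{k(j)}-measurable 𝔹-valued random variable and r(·, j) : (0,1) → ℝ_{≥0} a function such that P(‖Ẑ_j − μ‖ ≥ r(δ', j)) ≤ δ' for every δ' ∈ (0,1). Fix δ ∈ (0,1) and set, for each j ≥ 1: δ_j := δ/h(j), r_j := r(δ_j/2, j), λ_j := ( β·log(4/δ_j) / ( 2^j·(β·𝔠_p + K_p·2^{p−1})·(v + r_j^p) ) )^{1/p}, and for n > k(j): μ̂_n(j) := (1/(n−k(j)))·Σ_{m=k(j)+1}^n ( Trunc(λ_j(X_m − Ẑ_j))·(X_m − Ẑ_j) + Ẑ_j ). Define the stitched estimator μ̂_n := μ̂_n(⌊log₂ n⌋). Then with probability at least 1 − δ, simultaneously for all n ≥ n₀: ‖μ̂_n − μ‖ ≤ (2^{(p−1)/p} + 2^{1/p})·( (β·𝔠_p + K_p·2^{p−1})·(v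 + r_{⌊log₂ n⌋}^p) )^{1/p}·( β·log(4·h(⌊log₂ n⌋)/δ) / (n − k(⌊log₂ n⌋)) )^{(p−1)/p}. -/

import Mathlib

open MeasureTheory
open scoped Classical

/-- `truncB x = min(1, ‖x‖)/‖x‖` for `x ≠ 0`, and `truncB 0 = 1`; so `truncB x • x` is the
projection of `x` onto the closed unit ball. -/
noncomputable def truncB {B : Type*} [NormedAddCommGroup B] (x : B) : ℝ :=
  if x = 0 then 1 else min 1 ‖x‖ / ‖x‖

/-- `K_p = (1/p) ((p-1)/p)^{p-1}`. -/
noncomputable def Kp (p : ℝ) : ℝ := (1 / p) * ((p - 1) / p) ^ (p - 1)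

/-- `𝔠_p(ρ) = 2^{p+1} (e^{2ρ} - 2ρ - 1)/(2ρ)²`. -/
noncomputable def frakC (p ρ : ℝ) : ℝ :=
  2 ^ (p + 1) * (Real.exp (2 * ρ) - 2 * ρ - 1) / (2 * ρ) ^ 2

lemma s17_coshsqrt_conv {s t w z : ℝ} (hs : 0 ≤ s) (ht : 0 ≤ t) (hw : 0 ≤ w) (hz : 0 ≤ z)
    (hwz : w + z = 1) :
    Real.cosh (Real.sqrt (w * s + z * t)) ≤
      w * Real.cosh (Real.sqrt s) + z * Real.cosh (Real.sqrt t) := by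
  have h1 := Real.hasSum_cosh (Real.sqrt (w * s + z * t))
  have h2 := ((Real.hasSum_cosh (Real.sqrt s)).mul_left w).add
    ((Real.hasSum_cosh (Real.sqrt t)).mul_left z)
  refine hasSum_le (fun n => ?_) h1 h2
  rw [pow_mul, pow_mul, pow_mul, Real.sq_sqrt (by positivity), Real.sq_sqrt hs, Real.sq_sqrt ht]
  have := (convexOn_pow (𝕜 := ℝ) n).2 (Set.mem_Ici.2 hs) (Set.mem_Ici.2 ht) hw hz hwz
  simp only [smul_eq_mul] at this
  rw [← mul_div_assoc, ← mul_div_assoc, ← add_div]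
  gcongr

lemma s17_majorize {a b A D : ℝ} (ha : 0 ≤ a) (hb : 0 ≤ b) (hA : 0 ≤ A) (hD : 0 ≤ D)
    (haA : a ≤ A) (hbA : b ≤ A) (hsq : a ^ 2 + b ^ 2 ≤ A ^ 2 + D ^ 2) :
    Real.cosh a + Real.cosh b ≤ Real.cosh A + Real.cosh D := by
  have mono : ∀ {x y : ℝ}, 0 ≤ x → x ≤ y → Real.cosh x ≤ Real.cosh y := by
    intro x y hx hxy
    rw [Real.cosh_le_cosh, abs_of_nonneg hx, abs_of_nonneg (hx.trans hxy)]; exact hxy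
  by_cases hc : a ≤ D
  · linarith [mono ha hc, mono hb hbA]
  push Not at hc
  have hAD : D ^ 2 < A ^ 2 := by nlinarith
  set w := (a ^ 2 - D ^ 2) / (A ^ 2 - D ^ 2) with hw
  have hpos : 0 < A ^ 2 - D ^ 2 := by linarith
  have hw0 : 0 ≤ w := div_nonneg (by nlinarith) hpos.le
  have hw1 : w ≤ 1 := by rw [hw, div_le_one hpos]; nlinarith
  have hwe : w * (A ^ 2 - D ^ 2) = a ^ 2 - D ^ 2 := by rw [hw]; field_simp
  have e1 := s17_coshsqrt_conv (sq_nonneg A) (sq_nonneg D) hw0 (sub_nonneg.2 hw1) (by ring)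
  have e2 := s17_coshsqrt_conv (sq_nonneg A) (sq_nonneg D) (sub_nonneg.2 hw1) hw0 (by ring)
  rw [Real.sqrt_sq hA, Real.sqrt_sq hD] at e1 e2
  rw [show w * A ^ 2 + (1 - w) * D ^ 2 = a ^ 2 by linarith, Real.sqrt_sq ha] at e1
  rw [show (1 - w) * A ^ 2 + w * D ^ 2 = A ^ 2 + D ^ 2 - a ^ 2 by linarith] at e2
  have : b ≤ Real.sqrt (A ^ 2 + D ^ 2 - a ^ 2) := Real.le_sqrt_of_sq_le (by linarith)
  linarith [mono hb this]

lemma s17_exp_quot {x c : ℝ} (hx : 0 ≤ x) (hxc : x ≤ c) :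
    (Real.exp x - 1 - x) * c ^ 2 ≤ x ^ 2 * (Real.exp c - 1 - c) := by
  have key : ∀ y : ℝ, HasSum (fun n : ℕ => y ^ (n + 2) / (n + 2).factorial)
      (Real.exp y - 1 - y) := by
    intro y
    have h := NormedSpace.expSeries_div_hasSum_exp (𝔸 := ℝ) y
    rw [← Real.exp_eq_exp_ℝ] at h
    rw [← hasSum_nat_add_iff' 2] at h
    simpa [Finset.sum_range_succ, sub_sub] using h
  refine hasSum_le (fun n => ?_) ((key x).mul_right (c ^ 2)) ((key c).mul_left (x ^ 2))
  rw [div_mul_eq_mul_div, ← mul_div_assoc]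
  have : x ^ n ≤ c ^ n := pow_le_pow_left₀ hx hxc n
  have : x ^ (n + 2) * c ^ 2 ≤ x ^ 2 * c ^ (n + 2) := by
    calc x ^ (n + 2) * c ^ 2 = x ^ 2 * c ^ 2 * x ^ n := by ring
      _ ≤ x ^ 2 * c ^ 2 * c ^ n := by gcongr
      _ = _ := by ring
  gcongr

lemma s17_cosh_sub_one (x : ℝ) : 2 * (Real.cosh x - 1) ≤ x ^ 2 * Real.exp (x ^ 2 / 2) := by
  have h1 := Real.cosh_le_exp_half_sq x
  have h2 := Real.add_one_le_exp (-(x ^ 2 / 2))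
  have h3 : Real.exp (x ^ 2 / 2) * Real.exp (-(x ^ 2 / 2)) = 1 := by
    rw [← Real.exp_add]; simp
  have h4 := Real.exp_pos (x ^ 2 / 2)
  nlinarith [mul_le_mul_of_nonneg_left h2 h4.le]

lemma s17_cosh_add {a b : ℝ} (hb : 0 ≤ b) : Real.cosh (a + b) ≤ Real.cosh a * Real.exp b := by
  rw [Real.cosh_eq, Real.cosh_eq, neg_add, Real.exp_add, Real.exp_add]
  have : Real.exp (-b) ≤ Real.exp b := Real.exp_le_exp.2 (by linarith)
  nlinarith [mul_le_mul_of_nonneg_left this (Real.exp_pos (-a)).le]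

section geo
variable {B : Type*} [NormedAddCommGroup B] [NormedSpace ℝ B]

lemma s17_mono {x y : ℝ} (hx : 0 ≤ x) (hxy : x ≤ y) : Real.cosh x ≤ Real.cosh y := by
  rw [Real.cosh_le_cosh, abs_of_nonneg hx, abs_of_nonneg (hx.trans hxy)]; exact hxy

set_option linter.unusedSectionVars false in
lemma s17_mid {β : ℝ} (hβ : 1 ≤ β)
    (hsmooth : ∀ x y : B, ‖x + y‖ ^ 2 + ‖x - y‖ ^ 2 ≤ 2 * ‖x‖ ^ 2 + 2 * β ^ 2 * ‖y‖ ^ 2)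
    (x y : B) : Real.cosh ‖x + y‖ + Real.cosh ‖x - y‖ ≤
      2 * Real.cosh ‖x‖ * Real.cosh (β * ‖y‖) := by
  have h1 : ‖y‖ ≤ β * ‖y‖ := le_mul_of_one_le_left (norm_nonneg _) hβ
  have h2 := norm_add_le x y
  have h3 := norm_sub_le x y
  have := s17_majorize (norm_nonneg (x + y)) (norm_nonneg (x - y))
    (A := ‖x‖ + β * ‖y‖) (D := |‖x‖ - β * ‖y‖|) (by positivity) (abs_nonneg _)
    (by linarith) (by linarith) (by rw [sq_abs]; nlinarith [hsmooth x y])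
  rw [Real.cosh_abs, Real.cosh_add, Real.cosh_sub] at this
  linarith

/-- A norming functional, scaled. -/
noncomputable def s17L (x : B) : StrongDual ℝ B :=
  Real.sinh ‖x‖ • (exists_dual_vector'' ℝ x).choose

lemma s17L_sub (x y : B) : Real.cosh ‖x‖ + s17L x y ≤ Real.cosh ‖x + y‖ := by
  obtain ⟨hg1, hg2⟩ := (exists_dual_vector'' ℝ x).choose_spec
  simp only [s17L]
  set g := (exists_dual_vector'' ℝ x).choose
  have h1 : g (x + y) ≤ ‖x + y‖ := by
    refine (le_abs_self _).trans ((g.le_opNorm _).trans ?_)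
    exact mul_le_of_le_one_left (norm_nonneg _) hg1
  rw [map_add, hg2] at h1
  simp only [RCLike.ofReal_real_eq_id, id] at h1
  have hs : 0 ≤ Real.sinh ‖x‖ := Real.sinh_nonneg_iff.2 (norm_nonneg _)
  have h2 : Real.cosh ‖x‖ + Real.sinh ‖x‖ * (‖x + y‖ - ‖x‖) ≤ Real.cosh ‖x + y‖ := by
    set a := ‖x‖
    set b := ‖x + y‖
    have e : Real.cosh b = Real.cosh a * Real.cosh (b - a) + Real.sinh a * Real.sinh (b - a) := by
      rw [← Real.cosh_add]; congr 1; ring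
    have hq : ∀ t : ℝ, Real.cosh a + Real.sinh a * t ≤
        Real.cosh a * Real.cosh t + Real.sinh a * Real.sinh t := by
      intro t
      have i1 := Real.add_one_le_exp t
      have i2 := Real.add_one_le_exp (-t)
      have i3 : 0 < Real.cosh a - Real.sinh a := by
        rw [Real.cosh_sub_sinh]; exact Real.exp_pos _
      have i4 : 0 < Real.cosh a + Real.sinh a := by
        rw [Real.cosh_add_sinh]; exact Real.exp_pos _
      rw [Real.cosh_eq t, Real.sinh_eq t]
      nlinarith [mul_le_mul_of_nonneg_left i1 i4.le, mul_le_mul_of_nonneg_left i2 i3.le]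
    rw [e]; exact hq _
  have h3 : Real.sinh ‖x‖ * g y ≤ Real.sinh ‖x‖ * (‖x + y‖ - ‖x‖) := by
    gcongr; linarith
  simp only [smul_apply, smul_eq_mul]
  linarith

lemma s17L_norm (x : B) : ‖s17L x‖ ≤ Real.sinh ‖x‖ := by
  obtain ⟨hg1, hg2⟩ := (exists_dual_vector'' ℝ x).choose_spec
  have hs : 0 ≤ Real.sinh ‖x‖ := Real.sinh_nonneg_iff.2 (norm_nonneg _)
  rw [s17L, norm_smul, Real.norm_eq_abs, abs_of_nonneg hs]
  exact mul_le_of_le_one_right hs hg1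

lemma s17L_up {β : ℝ} (hβ : 1 ≤ β)
    (hsmooth : ∀ x y : B, ‖x + y‖ ^ 2 + ‖x - y‖ ^ 2 ≤ 2 * ‖x‖ ^ 2 + 2 * β ^ 2 * ‖y‖ ^ 2)
    (x y : B) : Real.cosh ‖x + y‖ ≤ Real.cosh ‖x‖ + s17L x y +
    2 * Real.cosh ‖x‖ * (Real.cosh (β * ‖y‖) - 1) := by
  have h1 := s17_mid hβ hsmooth x y
  have h2 := s17L_sub x (-y)
  rw [← sub_eq_add_neg, map_neg] at h2
  linarith

lemma s17L_cont {β : ℝ} (hβ : 1 ≤ β)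
    (hsmooth : ∀ x y : B, ‖x + y‖ ^ 2 + ‖x - y‖ ^ 2 ≤ 2 * ‖x‖ ^ 2 + 2 * β ^ 2 * ‖y‖ ^ 2)
    : Continuous (s17L : B → StrongDual ℝ B) := by
  rw [continuous_iff_continuousAt]
  intro z
  rw [ContinuousAt, tendsto_iff_norm_sub_tendsto_zero, Metric.tendsto_nhds]
  intro ε hε
  -- choose η
  set C := 2 * Real.cosh ‖z‖ with hC
  have hCpos : 0 < C := by have := Real.cosh_pos ‖z‖; positivity
  obtain ⟨η, hη, hηε⟩ : ∃ η : ℝ, 0 < η ∧ C * (Real.cosh (β * η) - 1) < η * (ε / 4) := by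
    have hd : HasDerivAt (fun t : ℝ => C * (Real.cosh (β * t) - 1)) 0 0 := by
      have := (((Real.hasDerivAt_cosh (β * 0)).comp 0
        ((hasDerivAt_id (0:ℝ)).const_mul β)).sub_const 1).const_mul C
      simpa [Function.comp_def] using this
    rw [hasDerivAt_iff_isLittleO] at hd
    have := hd.def (show (0:ℝ) < ε / 8 by positivity)
    rw [Metric.eventually_nhds_iff] at this
    obtain ⟨r, hr, hh⟩ := this
    refine ⟨r / 2, by positivity, ?_⟩
    have := hh (y := r / 2) (by simp [abs_of_pos hr]; linarith)
    simp only [mul_zero, Real.cosh_zero, sub_self, sub_zero, smul_eq_mul, Real.norm_eq_abs] at this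
    rw [abs_of_pos (show 0 < r / 2 by positivity)] at this
    have := (le_abs_self _).trans this
    have : 0 < r / 2 * ε := by positivity
    linarith
  -- uniform closeness of cosh norm
  have hM : ∀ᶠ x in nhds z, 2 * (Real.cosh (‖z‖ + η) * (Real.exp ‖x - z‖ - 1)) < η * (ε / 4) := by
    have : Filter.Tendsto (fun x : B => 2 * (Real.cosh (‖z‖ + η) * (Real.exp ‖x - z‖ - 1))) (nhds z)
        (nhds (2 * (Real.cosh (‖z‖ + η) * (Real.exp ‖z - z‖ - 1)))) := by
      apply Continuous.tendsto (f := fun x : B => 2 * (Real.cosh (‖z‖ + η) * (Real.exp ‖x - z‖ - 1)))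
      fun_prop
    refine this.eventually_lt_const ?_
    simp; positivity
  filter_upwards [hM] with x hx
  have hlip : ∀ y : B, ‖y‖ ≤ η → Real.cosh ‖x + y‖ - Real.cosh ‖z + y‖ ≤
      Real.cosh (‖z‖ + η) * (Real.exp ‖x - z‖ - 1) := by
    intro y hy
    have h1 : ‖x + y‖ ≤ ‖z + y‖ + ‖x - z‖ := by
      have := norm_add_le (z + y) (x - z)
      rwa [show z + y + (x - z) = x + y by abel] at this
    have h2 := (s17_mono (norm_nonneg _) h1).trans (s17_cosh_add (norm_nonneg (x - z)))
    have h3 : Real.cosh ‖z + y‖ ≤ Real.cosh (‖z‖ + η) :=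
      s17_mono (norm_nonneg _) ((norm_add_le _ _).trans (by linarith))
    have h4 : 0 ≤ Real.exp ‖x - z‖ - 1 := by
      have := Real.add_one_le_exp ‖x - z‖
      linarith [norm_nonneg (x - z)]
    nlinarith
  have hlip0 : Real.cosh ‖z‖ - Real.cosh ‖x‖ ≤
      Real.cosh (‖z‖ + η) * (Real.exp ‖x - z‖ - 1) := by
    by_cases hzx : ‖z‖ ≤ ‖x‖
    · have := s17_mono (norm_nonneg _) hzx
      have h4 : 0 ≤ Real.exp ‖x - z‖ - 1 := by
        have := Real.add_one_le_exp ‖x - z‖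
        linarith [norm_nonneg (x - z)]
      have := mul_nonneg (Real.cosh_pos (‖z‖ + η)).le h4
      linarith
    · push Not at hzx
      have h1 : ‖z‖ ≤ ‖x‖ + ‖x - z‖ := by
        have := norm_sub_norm_le z x
        rw [norm_sub_rev] at this; linarith
      have h2 := (s17_mono (norm_nonneg _) h1).trans (s17_cosh_add (norm_nonneg (x - z)))
      have h3 : Real.cosh ‖x‖ ≤ Real.cosh (‖z‖ + η) :=
        s17_mono (norm_nonneg _) (by linarith)
      have h4 : 0 ≤ Real.exp ‖x - z‖ - 1 := by
        have := Real.add_one_le_exp ‖x - z‖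
        linarith [norm_nonneg (x - z)]
      nlinarith
  have hkey : ∀ y : B, ‖y‖ = η → (s17L x - s17L z) y ≤ η * (ε / 2) := by
    intro y hy
    have h1 := s17L_sub x y
    have h2 := s17L_up hβ hsmooth z y
    have h3 := hlip y hy.le
    rw [hy] at h2
    rw [sub_apply]
    linarith
  rw [dist_zero_right, norm_norm]
  refine lt_of_le_of_lt (ContinuousLinearMap.opNorm_le_bound _ (by positivity : 0 ≤ ε / 2) ?_)
    (by linarith)
  intro y
  by_cases hy : y = 0
  · simp [hy]
  have hyn : 0 < ‖y‖ := norm_pos_iff.2 hy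
  have hs : ‖(η / ‖y‖) • y‖ = η := by
    rw [norm_smul, Real.norm_eq_abs, abs_of_pos (by positivity)]; field_simp
  have hsn : ‖-((η / ‖y‖) • y)‖ = η := by rw [norm_neg, hs]
  have k1 := hkey _ hs
  have k2 := hkey _ hsn
  rw [map_neg] at k2
  rw [map_smul, smul_eq_mul] at k1 k2
  have hq : 0 < η / ‖y‖ := by positivity
  have e1 : η * (ε / 2) = (η / ‖y‖) * (ε / 2 * ‖y‖) := by field_simp
  rw [e1] at k1 k2
  rw [Real.norm_eq_abs, abs_le]
  constructor
  · have := le_of_mul_le_mul_left (show (η / ‖y‖) * (-((s17L x - s17L z) y)) ≤ (η / ‖y‖) * (ε / 2 * ‖y‖) by linarith) hq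
    linarith
  · exact le_of_mul_le_mul_left k1 hq

lemma s17_pinelis {β : ℝ} (hβ : 1 ≤ β)
    (hsmooth : ∀ x y : B, ‖x + y‖ ^ 2 + ‖x - y‖ ^ 2 ≤ 2 * ‖x‖ ^ 2 + 2 * β ^ 2 * ‖y‖ ^ 2)
    (x d : B) : Real.cosh ‖x + d‖ ≤ Real.cosh ‖x‖ + s17L x d +
    β ^ 2 * Real.cosh ‖x‖ * (Real.exp ‖d‖ - 1 - ‖d‖) := by
  set D := ‖d‖ with hD
  by_cases hd0 : d = 0
  · simp [hd0, hD]
  have hDpos : 0 < D := norm_pos_iff.2 hd0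
  have main : ∀ N : ℕ, 0 < N → Real.cosh ‖x + d‖ ≤ Real.cosh ‖x‖ + s17L x d +
      β ^ 2 * Real.cosh ‖x‖ * (Real.exp (β ^ 2 * (D / N) ^ 2 / 2) *
        (Real.exp (D / N) * (Real.exp D - 1) - D)) := by
    intro N hN
    have hNr : (0:ℝ) < N := Nat.cast_pos.2 hN
    set u := D / N with hu
    have hupos : 0 < u := by positivity
    set y : B := (1 / (N:ℝ)) • d with hy
    have hyu : ‖y‖ = u := by
      rw [hy, norm_smul, Real.norm_eq_abs, abs_of_pos (by positivity), hu]; ring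
    set κ := 2 * (Real.cosh (β * u) - 1) with hκ
    have hκ0 : 0 ≤ κ := by have := Real.one_le_cosh (β * u); rw [hκ]; linarith
    set a : ℕ → ℝ := fun i => Real.cosh ‖x + (i:ℝ) • y‖ with ha
    set c := Real.cosh ‖x‖ with hc
    have hcpos : 0 < c := Real.cosh_pos _
    -- bound on norms
    have hnorm : ∀ i : ℕ, a i ≤ c * Real.exp (i * u) := by
      intro i
      have : ‖x + (i:ℝ) • y‖ ≤ ‖x‖ + i * u := by
        refine (norm_add_le _ _).trans ?_
        rw [norm_smul, hyu, Real.norm_eq_abs, abs_of_nonneg (by positivity)]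
      exact (s17_mono (norm_nonneg _) this).trans (s17_cosh_add (by positivity))
    have hdiff : ∀ i : ℕ, a (i + 1) - a i ≤ s17L x d / N + c * κ * ((Real.exp ((i + 1 : ℕ) * u) - 1) / u) := by
      have hexp : ∀ i : ℕ, Real.exp (i * u) ≤
          (Real.exp ((i + 1 : ℕ) * u) - 1) / u - (Real.exp (i * u) - 1) / u := by
        intro i
        rw [← sub_div, le_div_iff₀ hupos]
        have : Real.exp ((i + 1 : ℕ) * u) = Real.exp (i * u) * Real.exp u := by
          rw [← Real.exp_add]; push_cast; ring_nf
        rw [this]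
        have h1 := Real.add_one_le_exp u
        nlinarith [Real.exp_pos (i * u)]
      intro i
      induction i with
      | zero =>
        have h1 := s17L_up hβ hsmooth x y
        rw [hyu] at h1
        have h2 : s17L x y = s17L x d / N := by rw [hy, map_smul, smul_eq_mul]; ring
        have h3 := hexp 0
        simp only [Nat.cast_zero, zero_mul, Real.exp_zero, sub_self, zero_div, sub_zero] at h3
        have h4 := mul_le_mul_of_nonneg_left h3 (mul_nonneg hcpos.le hκ0)
        simp only [ha, Nat.cast_zero, zero_smul, add_zero, zero_add, Nat.cast_one, one_smul] at h4 ⊢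
        rw [h2] at h1
        rw [hκ] at h4 ⊢
        linarith
      | succ i ih =>
        have h1 := s17_mid hβ hsmooth (x + ((i+1:ℕ):ℝ) • y) y
        rw [hyu] at h1
        rw [show x + ((i+1:ℕ):ℝ) • y + y = x + ((i+1+1:ℕ):ℝ) • y by push_cast; module,
          show x + ((i+1:ℕ):ℝ) • y - y = x + ((i:ℕ):ℝ) • y by push_cast; module] at h1
        change a (i+1+1) + a i ≤ 2 * a (i+1) * _ at h1
        have h3 := mul_le_mul_of_nonneg_left (hexp (i+1)) (mul_nonneg hcpos.le hκ0)
        have h4 := mul_le_mul_of_nonneg_right (hnorm (i+1)) hκ0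
        have h5 : a (i+1+1) + a i - 2 * a (i+1) ≤ a (i+1) * κ := by rw [hκ]; linarith
        linarith
    have hsum : a N - a 0 ≤ s17L x d + c * κ * ((Real.exp u * (Real.exp D - 1) - D) / u ^ 2) := by
      have e1 : a N - a 0 = ∑ i ∈ Finset.range N, (a (i+1) - a i) := (Finset.sum_range_sub a N).symm
      rw [e1]
      refine (Finset.sum_le_sum fun i _ => hdiff i).trans ?_
      rw [Finset.sum_add_distrib, ← Finset.mul_sum, ← Finset.sum_div _ (fun i : ℕ => Real.exp ((i + 1 : ℕ) * u) - 1),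
        Finset.sum_sub_distrib]
      simp only [Finset.sum_const, Finset.card_range, nsmul_eq_mul, mul_one]
      have e2 : (N:ℝ) * (s17L x d / N) = s17L x d := by field_simp
      rw [e2]
      have e3 : ∑ i ∈ Finset.range N, Real.exp ((i + 1 : ℕ) * u) * u ≤ Real.exp u * (Real.exp D - 1) := by
        have : ∀ i ∈ Finset.range N, Real.exp ((i + 1 : ℕ) * u) * u ≤
            Real.exp u * (Real.exp ((i+1:ℕ) * u) - Real.exp ((i:ℕ) * u)) := by
          intro i _
          have : Real.exp ((i + 1 : ℕ) * u) = Real.exp (i * u) * Real.exp u := by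
            rw [← Real.exp_add]; push_cast; ring_nf
          rw [this]
          have h1 := Real.add_one_le_exp u
          nlinarith [mul_pos (Real.exp_pos (i * u)) (Real.exp_pos u)]
        refine (Finset.sum_le_sum this).trans ?_
        rw [← Finset.mul_sum, Finset.sum_range_sub (fun i : ℕ => Real.exp ((i:ℕ) * u))]
        have : (N:ℝ) * u = D := by rw [hu]; field_simp
        simp [this]
      rw [← Finset.sum_mul] at e3
      have hNu : (N:ℝ) = D / u := by rw [hu]; field_simp
      refine add_le_add le_rfl (mul_le_mul_of_nonneg_left ?_ (mul_nonneg hcpos.le hκ0))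
      rw [div_le_div_iff₀ hupos (by positivity)]
      have : (N:ℝ) * u = D := by rw [hu]; field_simp
      nlinarith
    have ha0 : a 0 = c := by simp [ha, hc]
    have haN : a N = Real.cosh ‖x + d‖ := by
      simp only [ha, hy, smul_smul]
      rw [mul_one_div_cancel hNr.ne', one_smul]
    rw [ha0, haN] at hsum
    have hq : 0 ≤ (Real.exp u * (Real.exp D - 1) - D) / u ^ 2 := by
      have h1 := Real.add_one_le_exp D
      have h2 := Real.one_le_exp hupos.le
      apply div_nonneg _ (by positivity)
      nlinarith
    have hκ1 : κ ≤ β ^ 2 * u ^ 2 * Real.exp (β ^ 2 * u ^ 2 / 2) := by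
      have := s17_cosh_sub_one (β * u); rwa [mul_pow] at this
    have := mul_le_mul_of_nonneg_right (mul_le_mul_of_nonneg_left hκ1 hcpos.le) hq
    have e : c * (β ^ 2 * u ^ 2 * Real.exp (β ^ 2 * u ^ 2 / 2)) *
        ((Real.exp u * (Real.exp D - 1) - D) / u ^ 2) = β ^ 2 * c * (Real.exp (β ^ 2 * u ^ 2 / 2) *
        (Real.exp u * (Real.exp D - 1) - D)) := by field_simp
    rw [e] at this
    linarith
  have hlim : Filter.Tendsto (fun N : ℕ => Real.cosh ‖x‖ + s17L x d +
      β ^ 2 * Real.cosh ‖x‖ * (Real.exp (β ^ 2 * (D / (N:ℝ)) ^ 2 / 2) *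
        (Real.exp (D / N) * (Real.exp D - 1) - D))) Filter.atTop
      (nhds (Real.cosh ‖x‖ + s17L x d +
      β ^ 2 * Real.cosh ‖x‖ * (Real.exp (β ^ 2 * (0:ℝ) ^ 2 / 2) *
        (Real.exp 0 * (Real.exp D - 1) - D)))) := by
    have h0 := tendsto_const_div_atTop_nhds_zero_nat D
    have hc : Continuous (fun u : ℝ => Real.cosh ‖x‖ + s17L x d +
      β ^ 2 * Real.cosh ‖x‖ * (Real.exp (β ^ 2 * u ^ 2 / 2) *
        (Real.exp u * (Real.exp D - 1) - D))) := by fun_prop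
    exact (hc.tendsto 0).comp h0
  have := ge_of_tendsto hlim (Filter.eventually_atTop.2 ⟨1, fun N hN => main N hN⟩)
  simpa using this

end geo


lemma s17_ville {Ω : Type*} {mΩ : MeasurableSpace Ω} {P : Measure Ω} [IsProbabilityMeasure P]
    (𝒢 : Filtration ℕ mΩ) (S : ℕ → Ω → ℝ) (hnn : ∀ n ω, 0 ≤ S n ω)
    (hm : ∀ n, StronglyMeasurable[𝒢 n] (S n)) (hi : ∀ n, Integrable (S n) P)
    (hsup : ∀ n, P[S (n + 1) | 𝒢 n] ≤ᵐ[P] S n) (h0 : ∫ ω, S 0 ω ∂P ≤ 1)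
    {a : ℝ} (ha : 0 < a) : P {ω | ∃ n, a ≤ S n ω} ≤ ENNReal.ofReal (1 / a) := by
  set A : ℕ → Set Ω := fun n => {ω | ∃ i ≤ n, a ≤ S i ω} with hA
  have hAm' : ∀ n, MeasurableSet[𝒢 n] (A n) := by
    intro n
    have : A n = ⋃ i ∈ Finset.range (n + 1), {ω | a ≤ S i ω} := by
      ext ω; simp [hA]
    rw [this]
    refine Finset.measurableSet_biUnion _ fun i hi => ?_
    have hin : i ≤ n := Nat.lt_succ_iff.1 (Finset.mem_range.1 hi)
    exact 𝒢.mono hin _ ((hm i).measurable measurableSet_Ici)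
  have hAm : ∀ n, MeasurableSet (A n) := fun n => 𝒢.le n _ (hAm' n)
  have hAmono : ∀ n, A n ⊆ A (n + 1) := fun n ω ⟨i, hi, h⟩ => ⟨i, hi.trans n.le_succ, h⟩
  have claim : ∀ n, a * P.real (A n) + ∫ ω in (A n)ᶜ, S n ω ∂P ≤ 1 := by
    intro n
    induction n with
    | zero =>
      have h1 : a * P.real (A 0) ≤ ∫ ω in A 0, S 0 ω ∂P := by
        have := setIntegral_mono_on (μ := P) (s := A 0) (f := fun _ => a) (g := S 0)
          (integrable_const a).integrableOn (hi 0).integrableOn (hAm 0) (by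
            rintro ω ⟨i, hi, h⟩
            obtain rfl : i = 0 := by omega
            exact h)
        rw [setIntegral_const, smul_eq_mul, mul_comm] at this
        exact this
      have := integral_add_compl (hAm 0) (hi 0)
      linarith
    | succ n ih =>
      have h1 : ∫ ω in (A n)ᶜ, S (n+1) ω ∂P ≤ ∫ ω in (A n)ᶜ, S n ω ∂P := by
        rw [← setIntegral_condExp (𝒢.le n) (hi (n+1)) (hAm' n).compl]
        exact setIntegral_mono_ae integrable_condExp.integrableOn (hi n).integrableOn (hsup n)
      have h2 : ∫ ω in (A n)ᶜ, S (n+1) ω ∂P =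
          (∫ ω in A (n+1) \ A n, S (n+1) ω ∂P) + ∫ ω in (A (n+1))ᶜ, S (n+1) ω ∂P := by
        rw [← setIntegral_union _ (hAm (n+1)).compl (hi _).integrableOn (hi _).integrableOn]
        · congr 2
          ext ω
          have := @hAmono n ω
          simp only [Set.mem_compl_iff, Set.mem_union, Set.mem_sdiff]
          tauto
        · rw [Set.disjoint_left]; rintro ω ⟨h1, _⟩ h2; exact h2 h1
      have h3 : a * P.real (A (n+1) \ A n) ≤ ∫ ω in A (n+1) \ A n, S (n+1) ω ∂P := by
        have := setIntegral_mono_on (μ := P) (s := A (n+1) \ A n) (f := fun _ => a) (g := S (n+1))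
          (integrable_const a).integrableOn (hi _).integrableOn ((hAm _).diff (hAm _)) (by
            rintro ω ⟨⟨i, hi, h⟩, h'⟩
            by_cases hin : i ≤ n
            · exact absurd ⟨i, hin, h⟩ h'
            · obtain rfl : i = n + 1 := by omega
              exact h)
        rw [setIntegral_const, smul_eq_mul, mul_comm] at this
        exact this
      have h4 : P.real (A (n+1) \ A n) = P.real (A (n+1)) - P.real (A n) :=
        measureReal_sdiff (hAmono n) (hAm n)
      rw [h4, mul_sub] at h3
      linarith
  have hAn : ∀ n, P (A n) ≤ ENNReal.ofReal (1 / a) := by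
    intro n
    have h1 := claim n
    have h2 : 0 ≤ ∫ ω in (A n)ᶜ, S n ω ∂P := integral_nonneg fun ω => hnn n ω
    rw [← ofReal_measureReal]
    apply ENNReal.ofReal_le_ofReal
    rw [le_div_iff₀ ha]; linarith
  have hU : {ω | ∃ n, a ≤ S n ω} = ⋃ n, A n := by
    ext ω; simp only [hA, Set.mem_ofPred_eq, Set.mem_iUnion]
    exact ⟨fun ⟨n, h⟩ => ⟨n, n, le_rfl, h⟩, fun ⟨n, i, _, h⟩ => ⟨i, h⟩⟩
  rw [hU, (monotone_nat_of_le_succ hAmono).measure_iUnion]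
  exact iSup_le hAn

lemma s17_step {B : Type*} [NormedAddCommGroup B] [NormedSpace ℝ B] [CompleteSpace B]
    {Ω : Type*} {m mΩ : MeasurableSpace Ω} {P : Measure Ω} [IsProbabilityMeasure P]
    {β : ℝ} (hβ : 1 ≤ β)
    (hsmooth : ∀ x y : B, ‖x + y‖ ^ 2 + ‖x - y‖ ^ 2 ≤ 2 * ‖x‖ ^ 2 + 2 * β ^ 2 * ‖y‖ ^ 2)
    (hm : m ≤ mΩ) {f d : Ω → B} (hf : StronglyMeasurable[m] f) (hd : StronglyMeasurable d)
    {C c b : ℝ} (hfC : ∀ᵐ ω ∂P, ‖f ω‖ ≤ C) (hdc : ∀ᵐ ω ∂P, ‖d ω‖ ≤ c)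
    (hd0 : P[d | m] =ᵐ[P] 0)
    (hq : ∀ᵐ ω ∂P, (P[fun ω => Real.exp ‖d ω‖ - 1 - ‖d ω‖ | m]) ω ≤ b) :
    P[fun ω => Real.cosh ‖f ω + d ω‖ | m] ≤ᵐ[P]
      fun ω => Real.exp (β ^ 2 * b) * Real.cosh ‖f ω‖ := by
  have hf' : StronglyMeasurable f := hf.mono hm
  have hdi : Integrable d P := Integrable.of_bound hd.aestronglyMeasurable c hdc
  have hqi : Integrable (fun ω => Real.exp ‖d ω‖ - 1 - ‖d ω‖) P := by
    refine Integrable.of_bound (C := Real.exp c + 1 + c) ?_ ?_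
    · exact ((Real.continuous_exp.comp_stronglyMeasurable hd.norm).sub
        stronglyMeasurable_const |>.sub hd.norm).aestronglyMeasurable
    · filter_upwards [hdc] with ω h
      rw [Real.norm_eq_abs, abs_le]
      have := Real.exp_le_exp.2 h
      have := Real.exp_pos ‖d ω‖
      have := norm_nonneg (d ω)
      constructor <;> linarith
  have hci : Integrable (fun ω => Real.cosh ‖f ω + d ω‖) P := by
    refine Integrable.of_bound (C := Real.cosh (C + c)) ?_ ?_
    · exact (Real.continuous_cosh.comp_stronglyMeasurable (hf'.add hd).norm).aestronglyMeasurable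
    · filter_upwards [hdc, hfC] with ω h h'
      rw [Real.norm_eq_abs, abs_of_pos (Real.cosh_pos _)]
      exact s17_mono (norm_nonneg _) ((norm_add_le _ _).trans (add_le_add h' h))
  have hcm : StronglyMeasurable[m] (fun ω => Real.cosh ‖f ω‖) :=
    Real.continuous_cosh.comp_stronglyMeasurable hf.norm
  have hcb : ∀ᵐ ω ∂P, ‖Real.cosh ‖f ω‖‖ ≤ Real.cosh C := by
    filter_upwards [hfC] with ω h
    rw [Real.norm_eq_abs, abs_of_pos (Real.cosh_pos _)]
    exact s17_mono (norm_nonneg _) h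
  have hfi : Integrable (fun ω => Real.cosh ‖f ω‖) P :=
    Integrable.of_bound (hcm.mono hm).aestronglyMeasurable _ hcb
  have hLm : StronglyMeasurable[m] (fun ω => s17L (f ω)) :=
    (s17L_cont hβ hsmooth).comp_stronglyMeasurable hf
  have hLb : ∀ᵐ ω ∂P, ‖s17L (f ω)‖ ≤ Real.sinh C := by
    filter_upwards [hfC] with ω h
    exact (s17L_norm _).trans (Real.sinh_le_sinh.2 h)
  have e1 := condExp_stronglyMeasurable_bilin_of_bound
    (ContinuousLinearMap.id ℝ (StrongDual ℝ B)) hm hLm hdi _ hLb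
  simp only [ContinuousLinearMap.id_apply] at e1
  have hLi : Integrable (fun ω => s17L (f ω) (d ω)) P := by
    refine Integrable.of_bound (C := Real.sinh C * c) ?_ ?_
    · exact ((ContinuousLinearMap.id ℝ (StrongDual ℝ B)).aestronglyMeasurable_comp₂
        (hLm.mono hm).aestronglyMeasurable hd.aestronglyMeasurable)
    · filter_upwards [hLb, hdc] with ω h h'
      exact ((s17L (f ω)).le_opNorm _).trans
        (mul_le_mul h h' (norm_nonneg _) ((norm_nonneg _).trans h))
  have e2 := condExp_stronglyMeasurable_mul_of_bound hm hcm hqi _ hcb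
  have hpi : Integrable ((fun ω => Real.cosh ‖f ω‖) *
      (fun ω => Real.exp ‖d ω‖ - 1 - ‖d ω‖)) P :=
    hqi.bdd_mul (hcm.mono hm).aestronglyMeasurable hcb
  set q : Ω → ℝ := (fun ω => Real.cosh ‖f ω‖) * (fun ω => Real.exp ‖d ω‖ - 1 - ‖d ω‖) with hqdef
  have hmono : P[fun ω => Real.cosh ‖f ω + d ω‖ | m] ≤ᵐ[P]
      P[((fun ω => Real.cosh ‖f ω‖) + fun ω => s17L (f ω) (d ω)) + (β ^ 2) • q | m] := by
    refine condExp_mono hci ((hfi.add hLi).add (hpi.smul _)) (Filter.Eventually.of_forall fun ω => ?_)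
    have := s17_pinelis hβ hsmooth (f ω) (d ω)
    simp only [hqdef, Pi.add_apply, Pi.smul_apply, Pi.mul_apply, smul_eq_mul]
    linarith
  have a1 := condExp_add (hfi.add hLi) (hpi.smul (β ^ 2)) m
  have a2 := condExp_add hfi hLi m
  have a3 := condExp_smul (μ := P) (β ^ 2) q m
  have a4 := condExp_of_stronglyMeasurable hm hcm hfi
  filter_upwards [hmono, a1, a2, a3, e1, e2, hd0, hq] with ω h1 h2 h3 h4 h5 h6 h7 h8
  rw [h2, Pi.add_apply, h3, Pi.add_apply, h4, Pi.smul_apply, h5, h6, a4, h7] at h1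
  simp only [Pi.mul_apply, Pi.zero_apply, map_zero, add_zero, smul_eq_mul] at h1
  have hpos := Real.cosh_pos ‖f ω‖
  have h9 := Real.add_one_le_exp (β ^ 2 * b)
  have h10 : β ^ 2 * (Real.cosh ‖f ω‖ * (P[fun ω => Real.exp ‖d ω‖ - 1 - ‖d ω‖ | m]) ω) ≤
      β ^ 2 * (Real.cosh ‖f ω‖ * b) := by gcongr
  nlinarith

section trunc
variable {B : Type*} [NormedAddCommGroup B] [NormedSpace ℝ B]

set_option linter.unusedSectionVars false in
lemma s17_trunc_eq (x : B) : truncB x = (max 1 ‖x‖)⁻¹ := by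
  unfold truncB
  split_ifs with h
  · simp [h]
  · have : 0 < ‖x‖ := norm_pos_iff.2 h
    rcases le_total 1 ‖x‖ with h1 | h1
    · rw [min_eq_left h1, max_eq_right h1, one_div]
    · rw [min_eq_right h1, max_eq_left h1, div_self this.ne', inv_one]

lemma s17_trunc_cont (l : ℝ) : Continuous (fun x : B => truncB (l • x) • x) := by
  simp only [s17_trunc_eq]
  refine Continuous.smul (Continuous.inv₀ (by fun_prop) fun x => ?_) continuous_id
  have : (1:ℝ) ≤ max 1 ‖l • x‖ := le_max_left _ _
  linarith

lemma s17_trunc_le (l : ℝ) (x : B) : ‖truncB (l • x) • x‖ ≤ ‖x‖ := by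
  rw [s17_trunc_eq, norm_smul, norm_inv]
  have : (1:ℝ) ≤ max 1 ‖l • x‖ := le_max_left _ _
  rw [Real.norm_eq_abs, abs_of_pos (by linarith)]
  exact mul_le_of_le_one_left (norm_nonneg _) (inv_le_one_of_one_le₀ this)

lemma s17_trunc_bd {l : ℝ} (hl : 0 < l) (x : B) : ‖truncB (l • x) • x‖ ≤ 1 / l := by
  rw [s17_trunc_eq, norm_smul, norm_inv]
  have h1 : (1:ℝ) ≤ max 1 ‖l • x‖ := le_max_left _ _
  have h2 : ‖l • x‖ ≤ max 1 ‖l • x‖ := le_max_right _ _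
  rw [Real.norm_eq_abs, abs_of_pos (by linarith), inv_mul_le_iff₀ (by linarith), mul_one_div,
    le_div_iff₀ hl]
  rw [norm_smul, Real.norm_eq_abs, abs_of_pos hl] at h2
  rw [norm_smul, Real.norm_eq_abs, abs_of_pos hl]
  linarith

lemma s17_Kp {p : ℝ} (hp : 1 < p) {u : ℝ} (hu : 0 ≤ u) : u - 1 ≤ Kp p * u ^ p := by
  -- tangent line at `p/(p-1)`
  set c := (p - 1) / p with hc
  have hp0 : 0 < p := by linarith
  have hc0 : 0 < c := div_pos (by linarith) hp0
  have h := one_add_mul_self_le_rpow_one_add (s := c * u - 1) (by nlinarith [mul_nonneg hc0.le hu])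
    hp.le
  rw [add_sub_cancel, Real.mul_rpow hc0.le hu] at h
  have hcp : c ^ p = c ^ (p - 1) * c := by
    rw [← Real.rpow_add_one hc0.ne']; ring_nf
  have hpc : p * c = p - 1 := by rw [hc]; field_simp
  have hK : Kp p = 1 / p * c ^ (p - 1) := rfl
  rw [hcp] at h
  -- multiply: (p-1) u + 1 - p ≤ c^(p-1) c u^p
  have h2 : (p - 1) * (u - 1) ≤ c ^ (p - 1) * c * u ^ p := by nlinarith
  have h3 : c ^ (p - 1) * c * u ^ p = (p - 1) * (Kp p * u ^ p) := by
    rw [hK, hc]; field_simp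
  rw [h3] at h2
  exact le_of_mul_le_mul_left h2 (by linarith)

lemma s17_Kp_nonneg {p : ℝ} (hp : 1 < p) : 0 ≤ Kp p := by
  unfold Kp
  have : 0 ≤ (p - 1) / p := div_nonneg (by linarith) (by linarith)
  have : 0 < p := by linarith
  positivity

lemma s17_trunc_sub {p : ℝ} (hp : 1 < p) {l : ℝ} (hl : 0 < l) (x : B) :
    ‖truncB (l • x) • x - x‖ ≤ Kp p * l ^ (p - 1) * ‖x‖ ^ p := by
  have e : truncB (l • x) • x - x = (truncB (l • x) - 1) • x := by rw [sub_smul, one_smul]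
  rw [e, s17_trunc_eq, norm_smul, norm_smul, Real.norm_eq_abs l, abs_of_pos hl]
  have h1 : (1:ℝ) ≤ max 1 (l * ‖x‖) := le_max_left _ _
  have h3 : (max 1 (l * ‖x‖))⁻¹ ≤ 1 := inv_le_one_of_one_le₀ h1
  rw [Real.norm_eq_abs, abs_sub_comm, abs_of_nonneg (by linarith)]
  rcases le_total (l * ‖x‖) 1 with h | h
  · rw [max_eq_left h]
    have := s17_Kp_nonneg hp
    simp; positivity
  · rw [max_eq_right h]
    have hx : 0 < ‖x‖ := by
      rcases (norm_nonneg x).eq_or_lt with h0 | h0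
      · rw [← h0] at h; simp at h; linarith
      · exact h0
    have h4 := s17_Kp hp (u := l * ‖x‖) (by positivity)
    rw [Real.mul_rpow hl.le hx.le] at h4
    have e2 : l ^ p = l ^ (p - 1) * l := by rw [← Real.rpow_add_one hl.ne']; ring_nf
    rw [e2] at h4
    have e3 : (1 - (l * ‖x‖)⁻¹) * ‖x‖ = (l * ‖x‖ - 1) / l := by field_simp
    rw [e3, div_le_iff₀ hl]
    linarith

lemma s17_pow_add {p a b : ℝ} (hp : 1 ≤ p) (ha : 0 ≤ a) (hb : 0 ≤ b) :
    (a + b) ^ p ≤ 2 ^ (p - 1) * (a ^ p + b ^ p) := by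
  have := NNReal.rpow_add_le_mul_rpow_add_rpow ⟨a, ha⟩ ⟨b, hb⟩ hp
  exact_mod_cast this
end trunc


/-- One-step facts for the truncated increments. -/
lemma s17_incr
    {B : Type*} [NormedAddCommGroup B] [NormedSpace ℝ B] [CompleteSpace B]
    {Ω : Type*} {m mΩ : MeasurableSpace Ω} {P : Measure Ω} [IsProbabilityMeasure P]
    {β : ℝ} (hβ : 1 ≤ β) (hm : m ≤ mΩ) (X Z : Ω → B) (μ : B) {p v r l : ℝ}
    (hp1 : 1 < p) (hp2 : p ≤ 2) (hl : 0 < l)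
    (hX : StronglyMeasurable X) (hint : Integrable X P)
    (hmom : Integrable (fun ω => ‖X ω‖ ^ p) P)
    (hcondmean : P[X | m] =ᵐ[P] fun _ => μ)
    (hcondmom : ∀ᵐ ω ∂P, (P[fun ω' => ‖X ω' - μ‖ ^ p | m]) ω ≤ v)
    (hZ : StronglyMeasurable[m] Z) (hZr : ∀ ω, ‖Z ω - μ‖ ≤ r)
    (Y D : Ω → B) (hY : Y = fun ω => truncB (l • (X ω - Z ω)) • (X ω - Z ω))
    (hD : D = Y - P[Y | m]) :
    (∀ᵐ ω ∂P, ‖D ω‖ ≤ 2 / l) ∧ P[D | m] =ᵐ[P] 0 ∧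
    (∀ᵐ ω ∂P, ‖(P[Y | m]) ω + Z ω - μ‖ ≤ l ^ (p - 1) * (Kp p * 2 ^ (p - 1)) * (v + r ^ p)) ∧
    (∀ᵐ ω ∂P, (P[fun ω => Real.exp ‖(l / β) • D ω‖ - 1 - ‖(l / β) • D ω‖ | m]) ω ≤
      (1 / β) ^ 2 * (frakC p (1 / β) * l ^ p * (v + r ^ p))) := by
  have hβ0 : 0 < β := by linarith
  have hZ' : StronglyMeasurable Z := hZ.mono hm
  have hYm : StronglyMeasurable Y := by
    rw [hY]; exact (s17_trunc_cont l).comp_stronglyMeasurable (hX.sub hZ')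
  have hYb : ∀ ω, ‖Y ω‖ ≤ 1 / l := fun ω => by rw [hY]; exact s17_trunc_bd hl _
  have hYi : Integrable Y P :=
    Integrable.of_bound hYm.aestronglyMeasurable _ (Filter.Eventually.of_forall hYb)
  have hEb : ∀ᵐ ω ∂P, ‖(P[Y | m]) ω‖ ≤ 1 / l :=
    ae_bdd_norm_condExp_of_ae_bdd_norm (Filter.Eventually.of_forall hYb)
  have hEm : StronglyMeasurable[m] (P[Y | m]) := stronglyMeasurable_condExp
  have hDm : StronglyMeasurable D := by rw [hD]; exact hYm.sub (hEm.mono hm)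
  have hDb : ∀ᵐ ω ∂P, ‖D ω‖ ≤ 2 / l := by
    filter_upwards [hEb] with ω h
    rw [hD, Pi.sub_apply]
    refine (norm_sub_le _ _).trans ?_
    have := hYb ω
    have e : 2 / l = 1 / l + 1 / l := by ring
    linarith
  have hZb : ∀ ω, ‖Z ω‖ ≤ r + ‖μ‖ := fun ω => by
    have := norm_add_le (Z ω - μ) μ
    rw [sub_add_cancel] at this
    linarith [hZr ω]
  have hZi : Integrable Z P :=
    Integrable.of_bound hZ'.aestronglyMeasurable _ (Filter.Eventually.of_forall hZb)
  -- moments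
  have hp0 : 0 ≤ p := by linarith
  have hXμ : Integrable (fun ω => ‖X ω - μ‖ ^ p) P := by
    refine Integrable.mono' ((hmom.add (integrable_const (‖μ‖ ^ p))).const_mul (2 ^ (p - 1)))
      ((Real.continuous_rpow_const hp0).comp_stronglyMeasurable
        (hX.sub stronglyMeasurable_const).norm).aestronglyMeasurable
      (Filter.Eventually.of_forall fun ω => ?_)
    rw [Real.norm_eq_abs, abs_of_nonneg (by positivity)]
    exact (Real.rpow_le_rpow (norm_nonneg _) (norm_sub_le _ _) hp0).trans
      (s17_pow_add hp1.le (norm_nonneg _) (norm_nonneg _))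
  set W : Ω → ℝ := fun ω => ‖X ω - Z ω‖ ^ p with hW
  have hWle : ∀ ω, W ω ≤ 2 ^ (p - 1) * (‖X ω - μ‖ ^ p + r ^ p) := by
    intro ω
    have h1 : ‖X ω - Z ω‖ ≤ ‖X ω - μ‖ + ‖Z ω - μ‖ := by
      have := norm_sub_le (X ω - μ) (Z ω - μ)
      rwa [sub_sub_sub_cancel_right] at this
    refine (Real.rpow_le_rpow (norm_nonneg _) h1 hp0).trans
      ((s17_pow_add hp1.le (norm_nonneg _) (norm_nonneg _)).trans ?_)
    have := Real.rpow_le_rpow (norm_nonneg _) (hZr ω) hp0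
    gcongr
  have hWi0 : Integrable ((2:ℝ) ^ (p - 1) • ((fun ω => ‖X ω - μ‖ ^ p) + fun _ => r ^ p)) P :=
    (hXμ.add (integrable_const _)).smul _
  have hWm : StronglyMeasurable W :=
    (Real.continuous_rpow_const hp0).comp_stronglyMeasurable (hX.sub hZ').norm
  have hWi : Integrable W P := by
    refine Integrable.mono' hWi0 hWm.aestronglyMeasurable (Filter.Eventually.of_forall fun ω => ?_)
    rw [Real.norm_eq_abs, abs_of_nonneg (by positivity)]
    exact hWle ω
  have hEW : ∀ᵐ ω ∂P, (P[W | m]) ω ≤ 2 ^ (p - 1) * (v + r ^ p) := by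
    have h1 := condExp_mono (m := m) hWi hWi0 (Filter.Eventually.of_forall hWle)
    have h2 := condExp_smul (μ := P) ((2:ℝ) ^ (p - 1)) ((fun ω => ‖X ω - μ‖ ^ p) + fun _ => r ^ p) m
    have h3 := condExp_add hXμ (integrable_const (r ^ p)) m
    filter_upwards [h1, h2, h3, hcondmom] with ω h1 h2 h3 h4
    rw [h2, Pi.smul_apply, h3, Pi.add_apply, condExp_const hm, smul_eq_mul] at h1
    refine h1.trans ?_
    gcongr
  refine ⟨hDb, ?_, ?_, ?_⟩
  · rw [hD]
    have h1 := condExp_sub hYi (integrable_condExp (μ := P) (m := m) (f := Y)) m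
    rw [condExp_of_stronglyMeasurable hm hEm integrable_condExp, sub_self] at h1
    exact h1
  · have h1 := condExp_sub hYi (hint.sub hZi) m
    have h2 := condExp_sub hint hZi m
    rw [condExp_of_stronglyMeasurable hm hZ hZi] at h2
    have h3 := norm_condExp_le (μ := P) (m := m) (Y - (X - Z))
    have h4 : P[(fun ω => ‖(Y - (X - Z)) ω‖) | m] ≤ᵐ[P] P[(Kp p * l ^ (p - 1)) • W | m] := by
      refine condExp_mono (hYi.sub (hint.sub hZi)).norm (hWi.smul _)
        (Filter.Eventually.of_forall fun ω => ?_)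
      rw [hY]
      exact s17_trunc_sub hp1 hl (X ω - Z ω)
    have h5 := condExp_smul (μ := P) (Kp p * l ^ (p - 1)) W m
    filter_upwards [h1, h2, h3, h4, h5, hEW, hcondmean] with ω h1 h2 h3 h4 h5 h6 h7
    have e : (P[Y | m]) ω + Z ω - μ = (P[Y - (X - Z) | m]) ω := by
      rw [h1, Pi.sub_apply, h2, Pi.sub_apply, h7]; abel
    rw [e]
    refine h3.trans (h4.trans ?_)
    rw [h5, Pi.smul_apply, smul_eq_mul]
    have := s17_Kp_nonneg hp1
    calc Kp p * l ^ (p - 1) * (P[W | m]) ω ≤ Kp p * l ^ (p - 1) * (2 ^ (p - 1) * (v + r ^ p)) := by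
          gcongr
      _ = _ := by ring
  · set ρ := 1 / β with hρ
    have hρ0 : 0 < ρ := by positivity
    set Q := (Real.exp (2 * ρ) - 1 - 2 * ρ) / (2 * ρ) ^ 2 with hQ
    have hQ0 : 0 ≤ Q := div_nonneg (by linarith [Real.add_one_le_exp (2 * ρ)]) (by positivity)
    set κ := Q * (ρ ^ 2 * (2 ^ (2 - p) * (l ^ p * 2 ^ (p - 1)))) with hκ
    have hκ0 : 0 ≤ κ := by positivity
    have hYW : ∀ ω, ‖Y ω‖ ^ p ≤ W ω := fun ω => by
      rw [hY]; exact Real.rpow_le_rpow (norm_nonneg _) (s17_trunc_le l _) hp0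
    have hYpi : Integrable (fun ω => ‖Y ω‖ ^ p) P := by
      refine Integrable.mono' hWi ((Real.continuous_rpow_const hp0).comp_stronglyMeasurable
        hYm.norm).aestronglyMeasurable (Filter.Eventually.of_forall fun ω => ?_)
      rw [Real.norm_eq_abs, abs_of_nonneg (by positivity)]
      exact hYW ω
    have hJ := Integrable.norm_condExp_rpow_le (m := m) hp1.le hYpi
    have hJ2 := condExp_mono (m := m) hYpi hWi (Filter.Eventually.of_forall hYW)
    have hpt : ∀ᵐ ω ∂P, Real.exp ‖(l / β) • D ω‖ - 1 - ‖(l / β) • D ω‖ ≤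
        (κ • (W + P[W | m])) ω := by
      filter_upwards [hDb, hJ, hJ2] with ω h1 h2 h3
      have hx : ‖(l / β) • D ω‖ = ρ * (l * ‖D ω‖) := by
        rw [norm_smul, Real.norm_eq_abs, abs_of_pos (by positivity), hρ]; ring
      have hlD : l * ‖D ω‖ ≤ 2 := by
        rw [le_div_iff₀ hl] at h1; linarith
      have hlD0 : 0 ≤ l * ‖D ω‖ := by positivity
      rw [hx]
      have e1 := s17_exp_quot (x := ρ * (l * ‖D ω‖)) (c := 2 * ρ) (by positivity) (by nlinarith)
      rw [← le_div_iff₀ (by positivity), mul_div_assoc] at e1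
      refine e1.trans ?_
      change _ * Q ≤ _
      have e2 : (l * ‖D ω‖) ^ 2 ≤ 2 ^ (2 - p) * (l * ‖D ω‖) ^ p := by
        rcases hlD0.eq_or_lt with h0 | h0
        · rw [← h0]; simp; positivity
        · have : (l * ‖D ω‖) ^ 2 = (l * ‖D ω‖) ^ (2 - p) * (l * ‖D ω‖) ^ p := by
            rw [← Real.rpow_add h0, sub_add_cancel]; norm_cast
          rw [this]
          have := Real.rpow_le_rpow hlD0 hlD (show 0 ≤ 2 - p by linarith)
          gcongr
      have e3 : ‖D ω‖ ^ p ≤ 2 ^ (p - 1) * (W ω + (P[W | m]) ω) := by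
        have i1 : ‖D ω‖ ≤ ‖Y ω‖ + ‖(P[Y | m]) ω‖ := by rw [hD]; exact norm_sub_le _ _
        refine (Real.rpow_le_rpow (norm_nonneg _) i1 hp0).trans
          ((s17_pow_add hp1.le (norm_nonneg _) (norm_nonneg _)).trans ?_)
        have i2 := hYW ω
        have i3 : ‖(P[Y | m]) ω‖ ^ p ≤ (P[W | m]) ω := le_trans h2 h3
        gcongr
      rw [Real.mul_rpow hl.le (norm_nonneg _)] at e2
      calc (ρ * (l * ‖D ω‖)) ^ 2 * Q = Q * (ρ ^ 2 * (l * ‖D ω‖) ^ 2) := by ring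
        _ ≤ Q * (ρ ^ 2 * (2 ^ (2 - p) * (l ^ p * (2 ^ (p - 1) * (W ω + (P[W | m]) ω))))) := by
            refine mul_le_mul_of_nonneg_left (mul_le_mul_of_nonneg_left (e2.trans ?_)
              (by positivity)) hQ0
            gcongr
        _ = (κ • (W + P[W | m])) ω := by
            simp only [Pi.smul_apply, Pi.add_apply, smul_eq_mul, hκ]; ring
    have hqi : Integrable (fun ω => Real.exp ‖(l / β) • D ω‖ - 1 - ‖(l / β) • D ω‖) P := by
      refine Integrable.mono' ((hWi.add (integrable_condExp (μ := P) (m := m) (f := W))).smul κ) ?_ ?_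
      · have := (hDm.const_smul (l / β)).norm
        exact ((Real.continuous_exp.comp_stronglyMeasurable this).sub
          stronglyMeasurable_const |>.sub this).aestronglyMeasurable
      · filter_upwards [hpt] with ω h
        rw [Real.norm_eq_abs, abs_of_nonneg]
        · exact h
        · linarith [Real.add_one_le_exp ‖(l / β) • D ω‖]
    have a1 := condExp_mono (m := m) hqi ((hWi.add (integrable_condExp (μ := P) (m := m) (f := W))).smul κ) hpt
    have a2 := condExp_smul (μ := P) κ (W + P[W | m]) m
    have a3 := condExp_add hWi (integrable_condExp (μ := P) (m := m) (f := W)) m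
    rw [condExp_of_stronglyMeasurable hm stronglyMeasurable_condExp integrable_condExp] at a3
    filter_upwards [a1, a2, a3, hEW] with ω a1 a2 a3 h
    rw [a2, Pi.smul_apply, a3, Pi.add_apply, smul_eq_mul] at a1
    refine a1.trans ?_
    have : κ * ((P[W | m]) ω + (P[W | m]) ω) ≤ κ * (2 * (2 ^ (p - 1) * (v + r ^ p))) := by
      gcongr; linarith
    refine this.trans (le_of_eq ?_)
    have hf : frakC p ρ = 2 ^ (p + 1) * Q := by rw [frakC, hQ]; ring
    have h2 : (2:ℝ) ^ (p + 1) = 2 ^ (2 - p) * 2 ^ (p - 1) * 2 * 2 ^ (p - 1) := by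
      rw [← Real.rpow_add two_pos, ← Real.rpow_add_one two_ne_zero, ← Real.rpow_add two_pos]
      congr 1; ring
    rw [hf, h2, hκ]; ring


/-- Positivity of the constant `𝔠_p(ρ)`. -/
lemma s17_frakC_pos {p ρ : ℝ} (hρ : 0 < ρ) : 0 < frakC p ρ := by
  unfold frakC
  have h1 : 2 * ρ + 1 < Real.exp (2 * ρ) := Real.add_one_lt_exp (by positivity)
  have h2 : 0 < Real.exp (2 * ρ) - 2 * ρ - 1 := by linarith
  have h3 : (0 : ℝ) < 2 ^ (p + 1) := Real.rpow_pos_of_pos (by norm_num) _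
  positivity

/-- Time-uniform bound for the centred partial sums with fixed truncation level. -/
lemma s17_core
    {B : Type*} [NormedAddCommGroup B] [NormedSpace ℝ B] [CompleteSpace B]
    {Ω : Type*} {mΩ : MeasurableSpace Ω} {P : Measure Ω} [IsProbabilityMeasure P]
    {β : ℝ} (hβ : 1 ≤ β)
    (hsmooth : ∀ x y : B, ‖x + y‖ ^ 2 + ‖x - y‖ ^ 2 ≤ 2 * ‖x‖ ^ 2 + 2 * β ^ 2 * ‖y‖ ^ 2)
    (ℱ : Filtration ℕ mΩ) (X : ℕ → Ω → B) (μ : B) {p v : ℝ}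
    (hp1 : 1 < p) (hp2 : p ≤ 2)
    (hadapted : ∀ n : ℕ, 1 ≤ n → StronglyMeasurable[ℱ n] (X n))
    (hint : ∀ n : ℕ, 1 ≤ n → Integrable (X n) P)
    (hmom : ∀ n : ℕ, 1 ≤ n → Integrable (fun ω => ‖X n ω‖ ^ p) P)
    (hcondmean : ∀ n : ℕ, P[X (n + 1) | ℱ n] =ᵐ[P] fun _ => μ)
    (hcondmom : ∀ n : ℕ, ∀ᵐ ω ∂P, (P[fun ω' => ‖X (n + 1) ω' - μ‖ ^ p | ℱ n]) ω ≤ v)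
    (k : ℕ) {l r η : ℝ} (hl : 0 < l) (hη : 0 < η) (Z : Ω → B)
    (hZ : StronglyMeasurable[ℱ k] Z) (hZr : ∀ ω, ‖Z ω - μ‖ ≤ r) :
    P {ω | ∃ i : ℕ, (i : ℝ) * (l ^ (p - 1) * (β * frakC p (1 / β) + Kp p * 2 ^ (p - 1)) *
        (v + r ^ p)) + β * Real.log (2 / η) / l <
        ‖∑ m ∈ Finset.Ioc k (k + i),
          (truncB (l • (X m ω - Z ω)) • (X m ω - Z ω) + Z ω - μ)‖} ≤ ENNReal.ofReal η := by
  have hβ0 : 0 < β := by linarith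
  set Y : ℕ → Ω → B := fun n ω => truncB (l • (X (n+1) ω - Z ω)) • (X (n+1) ω - Z ω) with hY
  set D : ℕ → Ω → B := fun t => Y (k + t) - P[Y (k + t) | ℱ (k + t)] with hD
  set c : ℝ := frakC p (1 / β) * l ^ p * (v + r ^ p) with hc
  have key := fun t : ℕ => s17_incr (P := P) hβ (ℱ.le (k + t)) (X (k + t + 1)) Z μ hp1 hp2 hl
    ((hadapted (k + t + 1) (by omega)).mono (ℱ.le _)) (hint _ (by omega)) (hmom _ (by omega))
    (hcondmean _) (hcondmom _) (hZ.mono (ℱ.mono (by omega))) hZr (Y (k + t)) (D t) rfl rfl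
  have hYm : ∀ t, StronglyMeasurable[ℱ (k + t + 1)] (Y (k + t)) := fun t =>
    (s17_trunc_cont l).comp_stronglyMeasurable
      ((hadapted (k + t + 1) (by omega)).sub (hZ.mono (ℱ.mono (by omega))))
  have hDm : ∀ t, StronglyMeasurable[ℱ (k + t + 1)] (D t) := fun t =>
    (hYm t).sub (stronglyMeasurable_condExp.mono (ℱ.mono (by omega)))
  set M : ℕ → Ω → B := fun i ω => ∑ t ∈ Finset.range i, D t ω with hM
  have hMm : ∀ i, StronglyMeasurable[ℱ (k + i)] (M i) := by
    intro i
    refine Finset.stronglyMeasurable_fun_sum _ fun t ht => ?_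
    exact (hDm t).mono (ℱ.mono (by have := Finset.mem_range.1 ht; omega))
  have hMb : ∀ i, ∀ᵐ ω ∂P, ‖M i ω‖ ≤ i * (2 / l) := by
    have h1 : ∀ᵐ ω ∂P, ∀ t, ‖D t ω‖ ≤ 2 / l := ae_all_iff.2 fun t => (key t).1
    intro i
    filter_upwards [h1] with ω hω
    calc ‖M i ω‖ ≤ ∑ t ∈ Finset.range i, ‖D t ω‖ := norm_sum_le _ _
      _ ≤ ∑ t ∈ Finset.range i, 2 / l := Finset.sum_le_sum fun t _ => hω t
      _ = _ := by simp
  let 𝒢 : Filtration ℕ mΩ := ⟨fun i => ℱ (k + i), fun i j hij => ℱ.mono (by omega), fun i => ℱ.le _⟩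
  set S : ℕ → Ω → ℝ := fun i ω => Real.exp (-(i * c)) * Real.cosh ‖(l / β) • M i ω‖ with hS
  have hCm : ∀ i, StronglyMeasurable[ℱ (k + i)] (fun ω => Real.cosh ‖(l / β) • M i ω‖) := fun i =>
    Real.continuous_cosh.comp_stronglyMeasurable ((hMm i).const_smul (l / β)).norm
  have hfb : ∀ i, ∀ᵐ ω ∂P, ‖(l / β) • M i ω‖ ≤ l / β * (i * (2 / l)) := by
    intro i
    filter_upwards [hMb i] with ω hω
    rw [norm_smul, Real.norm_of_nonneg (by positivity)]
    gcongr
  have hCi : ∀ i, Integrable (fun ω => Real.cosh ‖(l / β) • M i ω‖) P := by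
    intro i
    refine Integrable.of_bound ((hCm i).mono (ℱ.le _)).aestronglyMeasurable
      (Real.cosh (l / β * (i * (2 / l)))) ?_
    filter_upwards [hfb i] with ω hω
    rw [Real.norm_of_nonneg (Real.cosh_pos _).le, Real.cosh_le_cosh, abs_of_nonneg (norm_nonneg _)]
    exact hω.trans (le_abs_self _)
  have hville := s17_ville (P := P) 𝒢 S (fun n ω => by positivity)
    (fun n => (hCm n).const_mul _) (fun n => (hCi n).const_mul _) ?_ ?_ (a := 1 / η) (by positivity)
  rotate_left
  · intro n
    have hd0 : P[(l / β) • D n | ℱ (k + n)] =ᵐ[P] 0 := by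
      filter_upwards [condExp_smul (μ := P) (l / β) (D n) (ℱ (k + n)), (key n).2.1] with ω h1 h2
      rw [h1, Pi.smul_apply, h2]; simp
    have hst := s17_step (P := P) hβ hsmooth (ℱ.le (k + n)) ((hMm n).const_smul (l / β))
      (((hDm n).mono (ℱ.le _)).const_smul (l / β)) (c := 2 / β) (hfb n) ?_ hd0 (key n).2.2.2
    · have e1 : S (n + 1) = Real.exp (-((n + 1 : ℕ) * c)) •
          fun ω => Real.cosh ‖((l / β) • M n) ω + ((l / β) • D n) ω‖ := by
        funext ω
        simp only [hS, hM, Pi.smul_apply, smul_eq_mul, Finset.sum_range_succ, smul_add]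
      have e2 := condExp_smul (μ := P) (Real.exp (-((n + 1 : ℕ) * c)))
        (fun ω => Real.cosh ‖((l / β) • M n) ω + ((l / β) • D n) ω‖) (ℱ (k + n))
      change P[S (n+1) | ℱ (k + n)] ≤ᵐ[P] S n
      rw [e1]
      filter_upwards [hst, e2] with ω h1 h2
      rw [h2, Pi.smul_apply, smul_eq_mul]
      refine (mul_le_mul_of_nonneg_left h1 (Real.exp_pos _).le).trans (le_of_eq ?_)
      simp only [hS, Pi.smul_apply]
      rw [← mul_assoc, ← Real.exp_add]
      congr 2
      have : β ^ 2 * ((1 / β) ^ 2 * c) = c := by field_simp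
      rw [this]; push_cast; ring
    · filter_upwards [(key n).1] with ω hω
      rw [Pi.smul_apply, norm_smul, Real.norm_of_nonneg (by positivity)]
      calc l / β * ‖D n ω‖ ≤ l / β * (2 / l) := by gcongr
        _ = 2 / β := by field_simp
  · simp [hS, hM]
  rw [one_div_one_div] at hville
  refine (measure_mono_ae ?_).trans hville
  have hbias : ∀ᵐ ω ∂P, ∀ t, ‖(P[Y (k + t) | ℱ (k + t)]) ω + Z ω - μ‖ ≤
      l ^ (p - 1) * (Kp p * 2 ^ (p - 1)) * (v + r ^ p) := ae_all_iff.2 fun t => (key t).2.2.1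
  filter_upwards [hbias] with ω hω
  rintro ⟨i, hi⟩
  refine ⟨i, ?_⟩
  by_contra hlt
  push Not at hlt
  refine absurd hi (not_lt.2 ?_)
  have hsum : ∑ m ∈ Finset.Ioc k (k + i),
      (truncB (l • (X m ω - Z ω)) • (X m ω - Z ω) + Z ω - μ) =
      M i ω + ∑ t ∈ Finset.range i, ((P[Y (k + t) | ℱ (k + t)]) ω + Z ω - μ) := by
    have e : Finset.Ioc k (k + i) = (Finset.range i).image (fun t => k + t + 1) := by
      ext m; simp only [Finset.mem_Ioc, Finset.mem_image, Finset.mem_range]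
      constructor
      · rintro ⟨h1, h2⟩; exact ⟨m - k - 1, by omega, by omega⟩
      · rintro ⟨t, h1, h2⟩; omega
    rw [e, Finset.sum_image (by intro a _ b _ hab; simpa using hab), hM, ← Finset.sum_add_distrib]
    refine Finset.sum_congr rfl fun t _ => ?_
    simp only [hD, Pi.sub_apply, hY]
    abel
  have hbs : ‖∑ t ∈ Finset.range i, ((P[Y (k + t) | ℱ (k + t)]) ω + Z ω - μ)‖ ≤
      i * (l ^ (p - 1) * (Kp p * 2 ^ (p - 1)) * (v + r ^ p)) := by
    refine (norm_sum_le _ _).trans ((Finset.sum_le_sum fun t _ => hω t).trans ?_)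
    simp
  have hMi : ‖M i ω‖ ≤ β * Real.log (2 / η) / l + i * (β * frakC p (1 / β) * l ^ (p - 1) * (v + r ^ p)) := by
    set x := l / β * ‖M i ω‖ with hx
    have hx' : ‖(l / β) • M i ω‖ = x := by
      rw [norm_smul, Real.norm_of_nonneg (by positivity)]
    have h1 : Real.exp x / 2 ≤ Real.cosh x := by
      rw [Real.cosh_eq]; have := Real.exp_pos (-x); linarith
    have h2 : Real.exp (-(i * c)) * Real.cosh x < 1 / η := by rw [← hx']; exact hlt
    have h3 : Real.exp (x - i * c) < 2 / η := by
      have e : Real.exp (x - i * c) = 2 * (Real.exp (-(i * c)) * (Real.exp x / 2)) := by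
        rw [sub_eq_add_neg, Real.exp_add]; ring
      have := mul_le_mul_of_nonneg_left h1 (Real.exp_pos (-(i * c))).le
      rw [e]
      calc _ < 2 * (1 / η) := by linarith
        _ = 2 / η := by ring
    have h4 : x - i * c ≤ Real.log (2 / η) := (Real.le_log_iff_exp_le (by positivity)).2 h3.le
    have h5 : ‖M i ω‖ = β / l * x := by rw [hx]; field_simp
    have h6 : l ^ p = l ^ (p - 1) * l := by
      rw [← Real.rpow_add_one hl.ne']; congr 1; ring
    calc ‖M i ω‖ = β / l * x := h5
      _ ≤ β / l * (Real.log (2 / η) + i * c) := by gcongr; linarith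
      _ = _ := by rw [hc, h6]; field_simp
  rw [hsum]
  refine (norm_add_le _ _).trans ((add_le_add hMi hbs).trans (le_of_eq ?_))
  ring


/-- Optimised truncation level: the deterministic computation. -/
lemma s17_det {p b A V T N lam : ℝ} (hp1 : 1 < p) (hb : 0 < b) (hA : 0 < A) (hV : 0 < V)
    (hT : 0 < T) (hN : 0 < N) (hTN : T ≤ 2 * N) (hNT : N ≤ 2 * T)
    (hlam : lam = (b / (T * A * V)) ^ (1 / p)) :
    lam ^ (p - 1) * A * V + b / lam / N ≤
      (2 ^ ((p - 1) / p) + 2 ^ (1 / p)) * (A * V) ^ (1 / p) * (b / N) ^ ((p - 1) / p) := by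
  have hp0 : 0 < p := by linarith
  have hW : 0 < A * V := by positivity
  have hTAV : T * A * V = T * (A * V) := by ring
  rw [hTAV] at hlam
  rw [mul_assoc]
  generalize A * V = W at *
  have hq : 0 ≤ (p - 1) / p := div_nonneg (by linarith) hp0.le
  have hqs : (p - 1) / p + 1 / p = 1 := by field_simp; ring
  have hsplit : ∀ x : ℝ, 0 < x → x ^ ((p - 1) / p) * x ^ (1 / p) = x := fun x hx => by
    rw [← Real.rpow_add hx, hqs, Real.rpow_one]
  have h1 : lam ^ (p - 1) * W = W ^ (1 / p) * (b / T) ^ ((p - 1) / p) := by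
    have e1 : lam ^ (p - 1) = (b / T / W) ^ ((p - 1) / p) := by
      rw [hlam, ← Real.rpow_mul (by positivity), div_div]; congr 1; ring
    rw [e1, Real.div_rpow (by positivity) hW.le]
    have e2 := hsplit W hW
    have e3 : 0 < W ^ ((p - 1) / p) := by positivity
    rw [div_mul_eq_mul_div, div_eq_iff e3.ne']
    nth_rewrite 1 [← e2]; ring
  have h2 : b / lam / N = W ^ (1 / p) * (T / N) ^ (1 / p) * (b / N) ^ ((p - 1) / p) := by
    have hl0 : 0 < lam := by rw [hlam]; positivity
    have e1 : W ^ (1 / p) * (T / N) ^ (1 / p) * lam = (b / N) ^ (1 / p) := by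
      rw [hlam, ← Real.mul_rpow (by positivity) (by positivity),
        ← Real.mul_rpow (by positivity) (by positivity)]
      congr 1; field_simp
    have e2 := hsplit (b / N) (by positivity)
    rw [div_right_comm, div_eq_iff hl0.ne']
    nth_rewrite 1 [← e2]; rw [← e1]; ring
  have h3 : (b / T) ^ ((p - 1) / p) ≤ 2 ^ ((p - 1) / p) * (b / N) ^ ((p - 1) / p) := by
    rw [← Real.mul_rpow (by norm_num) (by positivity)]
    refine Real.rpow_le_rpow (by positivity) ?_ hq
    rw [← mul_div_assoc, div_le_div_iff₀ hT hN]
    nlinarith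
  have h4 : (T / N) ^ (1 / p) ≤ 2 ^ (1 / p) := by
    refine Real.rpow_le_rpow (by positivity) ?_ (by positivity)
    rwa [div_le_iff₀ hN]
  rw [h1, h2]
  have hW' : 0 < W ^ (1 / p) := by positivity
  have hbN : 0 < (b / N) ^ ((p - 1) / p) := by positivity
  calc _ ≤ W ^ (1 / p) * (2 ^ ((p - 1) / p) * (b / N) ^ ((p - 1) / p)) +
        W ^ (1 / p) * 2 ^ (1 / p) * (b / N) ^ ((p - 1) / p) := by gcongr
    _ = _ := by ring

/-- **Stitched (law-of-the-iterated-logarithm) bound for the truncated mean estimator.**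
With geometric epochs `[2ʲ, 2ʲ⁺¹)`, per-epoch centerings `Ẑⱼ` (measurable w.r.t.
`F_{k(j)}`, with tail-bound function `r`), stitching function `h`, and the per-epoch
optimized truncation levels `λⱼ`, with probability at least `1 - δ`, simultaneously for
all `n ≥ n₀`, the stitched estimator `μ̂ₙ = μ̂ₙ(⌊log₂ n⌋)` satisfies
`‖μ̂ₙ - μ‖ ≤ (2^{(p-1)/p} + 2^{1/p})((β𝔠_p + K_p2^{p-1})(v + r_{⌊log₂ n⌋}^p))^{1/p}
(β log(4h(⌊log₂ n⌋)/δ)/(n - k(⌊log₂ n⌋)))^{(p-1)/p}`. -/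
theorem stmt17
    {B : Type*} [NormedAddCommGroup B] [NormedSpace ℝ B] [CompleteSpace B]
    [TopologicalSpace.SeparableSpace B]
    {Ω : Type*} {mΩ : MeasurableSpace Ω} {P : Measure Ω} [IsProbabilityMeasure P]
    (β : ℝ) (hβ : 1 ≤ β)
    (hsmooth : ∀ x y : B, ‖x + y‖ ^ 2 + ‖x - y‖ ^ 2 ≤ 2 * ‖x‖ ^ 2 + 2 * β ^ 2 * ‖y‖ ^ 2)
    (ℱ : Filtration ℕ mΩ) (X : ℕ → Ω → B) (μ : B) (p v : ℝ)
    (hp1 : 1 < p) (hp2 : p ≤ 2) (hv : 0 < v)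
    (hadapted : ∀ n : ℕ, 1 ≤ n → StronglyMeasurable[ℱ n] (X n))
    (hint : ∀ n : ℕ, 1 ≤ n → Integrable (X n) P)
    (hmom : ∀ n : ℕ, 1 ≤ n → Integrable (fun ω => ‖X n ω‖ ^ p) P)
    (hcondmean : ∀ n : ℕ, P[X (n + 1) | ℱ n] =ᵐ[P] fun _ => μ)
    (hcondmom : ∀ n : ℕ, ∀ᵐ ω ∂P, (P[fun ω' => ‖X (n + 1) ω' - μ‖ ^ p | ℱ n]) ω ≤ v)
    (h : ℕ → ℝ) (hh1 : ∀ j : ℕ, 1 ≤ j → 1 ≤ h j)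
    (hhsum : Summable (fun j : ℕ => 1 / h (j + 1))) (hhle : (∑' j : ℕ, 1 / h (j + 1)) ≤ 1)
    (k : ℕ → ℕ) (hkmono : Monotone k)
    (n₀ : ℕ) (hn₀ : 2 ≤ n₀) (hkhalf : ∀ n : ℕ, n₀ ≤ n → (k (Nat.log 2 n) : ℝ) ≤ (n : ℝ) / 2)
    (Z : ℕ → Ω → B) (hZmeas : ∀ j : ℕ, 1 ≤ j → StronglyMeasurable[ℱ (k j)] (Z j))
    (r : ℝ → ℕ → ℝ) (hr_nonneg : ∀ x j, 0 ≤ r x j)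
    (hr : ∀ δ' ∈ Set.Ioo (0 : ℝ) 1, ∀ j : ℕ, 1 ≤ j →
      P {ω | r δ' j ≤ ‖Z j ω - μ‖} ≤ ENNReal.ofReal δ')
    (δ : ℝ) (hδ : δ ∈ Set.Ioo (0 : ℝ) 1) :
    ENNReal.ofReal (1 - δ) ≤
      P {ω | ∀ n : ℕ, n₀ ≤ n →
        let j := Nat.log 2 n
        let rj := r (δ / h j / 2) j
        let lamj := (β * Real.log (4 / (δ / h j)) /
          ((2 : ℝ) ^ j * (β * frakC p (1 / β) + Kp p * 2 ^ (p - 1)) * (v + rj ^ p))) ^ (1 / p)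
        ‖((n : ℝ) - k j)⁻¹ • (∑ m ∈ Finset.Ioc (k j) n,
            (truncB (lamj • (X m ω - Z j ω)) • (X m ω - Z j ω) + Z j ω)) - μ‖ ≤
          (2 ^ ((p - 1) / p) + 2 ^ (1 / p)) *
            ((β * frakC p (1 / β) + Kp p * 2 ^ (p - 1)) * (v + rj ^ p)) ^ (1 / p) *
            (β * Real.log (4 * h j / δ) / ((n : ℝ) - k j)) ^ ((p - 1) / p)} := by
  obtain ⟨hδ0, hδ1⟩ := hδ
  have hβ0 : 0 < β := by linarith
  have hA : 0 < β * frakC p (1 / β) + Kp p * 2 ^ (p - 1) := by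
    have h1 : 0 < frakC p (1 / β) := s17_frakC_pos (by positivity)
    have h2 := s17_Kp_nonneg hp1
    have h3 : (0 : ℝ) < 2 ^ (p - 1) := Real.rpow_pos_of_pos (by norm_num) _
    positivity
  set A := β * frakC p (1 / β) + Kp p * 2 ^ (p - 1) with hAdef
  set R : ℕ → ℝ := fun j => r (δ / h j / 2) j with hR
  set lam : ℕ → ℝ := fun j => (β * Real.log (4 / (δ / h j)) /
          ((2 : ℝ) ^ j * A * (v + (R j) ^ p))) ^ (1 / p) with hlam
  have hR0 : ∀ j, 0 ≤ R j := fun j => hr_nonneg _ _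
  have hV : ∀ j, 0 < v + (R j) ^ p := fun j => by
    have := Real.rpow_nonneg (hR0 j) p; linarith
  have hδj : ∀ j, 1 ≤ j → 0 < δ / h j ∧ δ / h j < 1 := fun j hj => by
    have := hh1 j hj
    refine ⟨by positivity, ?_⟩
    rw [div_lt_one (by linarith)]; linarith
  have hL : ∀ j, 1 ≤ j → 0 < Real.log (4 / (δ / h j)) := fun j hj => by
    obtain ⟨h1, h2⟩ := hδj j hj
    apply Real.log_pos
    rw [one_lt_div h1]; linarith
  have hlam0 : ∀ j, 1 ≤ j → 0 < lam j := fun j hj => by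
    have h1 := hL j hj
    have h2 := hV j
    simp only [hlam]
    positivity
  set Z' : ℕ → Ω → B := fun j ω => if ‖Z j ω - μ‖ < R j then Z j ω else μ with hZ'
  set bad2 : ℕ → Set Ω := fun j => {ω | ∃ i : ℕ, (i : ℝ) * ((lam j) ^ (p - 1) * A *
        (v + (R j) ^ p)) + β * Real.log (2 / (δ / h j / 2)) / lam j <
        ‖∑ m ∈ Finset.Ioc (k j) (k j + i),
          (truncB (lam j • (X m ω - Z' j ω)) • (X m ω - Z' j ω) + Z' j ω - μ)‖} with hbad2
  set bad : ℕ → Set Ω := fun j => {ω | R j ≤ ‖Z j ω - μ‖} ∪ bad2 j with hbad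
  have hPbad : ∀ j, 1 ≤ j → P (bad j) ≤ ENNReal.ofReal (δ / h j) := by
    intro j hj
    obtain ⟨h1, h2⟩ := hδj j hj
    have hb1 : P {ω | R j ≤ ‖Z j ω - μ‖} ≤ ENNReal.ofReal (δ / h j / 2) :=
      hr _ ⟨by positivity, by linarith⟩ j hj
    have hb2 : P (bad2 j) ≤ ENNReal.ofReal (δ / h j / 2) := by
      refine s17_core hβ hsmooth ℱ X μ hp1 hp2 hadapted hint hmom hcondmean hcondmom (k j)
        (hlam0 j hj) (by positivity) (Z' j) ?_ ?_
      · refine StronglyMeasurable.ite ?_ (hZmeas j hj) stronglyMeasurable_const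
        exact StronglyMeasurable.measurableSet_lt
          (((hZmeas j hj).sub stronglyMeasurable_const).norm) stronglyMeasurable_const
      · intro ω
        simp only [hZ']
        split_ifs with hif
        · exact hif.le
        · simpa using hR0 j
    calc P (bad j) ≤ P {ω | R j ≤ ‖Z j ω - μ‖} + P (bad2 j) := measure_union_le _ _
      _ ≤ ENNReal.ofReal (δ / h j / 2) + ENNReal.ofReal (δ / h j / 2) := add_le_add hb1 hb2
      _ = ENNReal.ofReal (δ / h j) := by
        rw [← ENNReal.ofReal_add (by positivity) (by positivity)]; congr 1; ring
  have hUnion : P (⋃ j : ℕ, bad (j + 1)) ≤ ENNReal.ofReal δ := by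
    have hs : Summable (fun j : ℕ => δ / h (j + 1)) := by
      simpa [div_eq_mul_inv] using hhsum.mul_left δ
    calc P (⋃ j : ℕ, bad (j + 1)) ≤ ∑' j : ℕ, P (bad (j + 1)) := measure_iUnion_le _
      _ ≤ ∑' j : ℕ, ENNReal.ofReal (δ / h (j + 1)) :=
        ENNReal.tsum_le_tsum fun j => hPbad _ (by omega)
      _ = ENNReal.ofReal (∑' j : ℕ, δ / h (j + 1)) :=
        (ENNReal.ofReal_tsum_of_nonneg (fun j => (hδj _ (by omega)).1.le) hs).symm
      _ ≤ ENNReal.ofReal δ := by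
        apply ENNReal.ofReal_le_ofReal
        have e : (fun j : ℕ => δ / h (j + 1)) = fun j => δ * (1 / h (j + 1)) := by
          funext j; ring
        rw [e, tsum_mul_left]
        nlinarith
  have hfin : ∀ G : Set Ω, Gᶜ ⊆ (⋃ j : ℕ, bad (j + 1)) → ENNReal.ofReal (1 - δ) ≤ P G := by
    intro G hG
    have h1 : (1 : ENNReal) ≤ P G + ENNReal.ofReal δ := by
      calc (1 : ENNReal) = P Set.univ := measure_univ.symm
        _ = P (G ∪ Gᶜ) := by rw [Set.union_compl_self]
        _ ≤ P G + P Gᶜ := measure_union_le _ _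
        _ ≤ P G + ENNReal.ofReal δ := by gcongr; exact (measure_mono hG).trans hUnion
    rw [ENNReal.ofReal_sub _ hδ0.le, ENNReal.ofReal_one]
    exact tsub_le_iff_right.2 h1
  apply hfin
  rw [Set.compl_subset_comm]
  intro ω hω n hn
  have hn2 : 2 ≤ n := hn₀.trans hn
  intro j
  have hj1 : 1 ≤ j := Nat.log_pos (by norm_num) hn2
  have hk := hkhalf n hn
  change (k j : ℝ) ≤ n / 2 at hk
  have hlo : ((2 : ℝ) ^ j) ≤ n := by exact_mod_cast Nat.pow_log_le_self 2 (by omega)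
  have hhi : (n : ℝ) < 2 * 2 ^ j := by
    have : n < 2 ^ (j + 1) := Nat.lt_pow_succ_log_self (by norm_num) n
    have h' : (n : ℝ) < 2 ^ (j + 1) := by exact_mod_cast this
    rw [pow_succ] at h'; linarith
  clear_value j
  intro rj lamj
  change ‖((n : ℝ) - k j)⁻¹ • (∑ m ∈ Finset.Ioc (k j) n,
            (truncB (lam j • (X m ω - Z j ω)) • (X m ω - Z j ω) + Z j ω)) - μ‖ ≤
          (2 ^ ((p - 1) / p) + 2 ^ (1 / p)) *
            (A * (v + (R j) ^ p)) ^ (1 / p) *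
            (β * Real.log (4 * h j / δ) / ((n : ℝ) - k j)) ^ ((p - 1) / p)
  have hn0 : (2 : ℝ) ≤ n := by exact_mod_cast hn2
  have hkn : k j ≤ n := by
    have : (k j : ℝ) ≤ n := by linarith
    exact_mod_cast this
  have hN0 : 0 < (n : ℝ) - k j := by linarith
  have hk0 : (0 : ℝ) ≤ k j := Nat.cast_nonneg _
  have hωj : ω ∉ bad j := by
    intro hb
    apply hω
    rw [Set.mem_iUnion]
    exact ⟨j - 1, by rwa [Nat.sub_add_cancel hj1]⟩
  simp only [hbad, Set.mem_union, not_or] at hωj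
  obtain ⟨hω1, hω2⟩ := hωj
  have hZe : Z' j ω = Z j ω := by
    simp only [hZ']
    rw [if_pos]
    simpa using hω1
  simp only [hbad2, Set.mem_ofPred_eq, not_exists, not_lt, hZe] at hω2
  obtain ⟨i, rfl⟩ := Nat.exists_eq_add_of_le hkn
  have hNi : ((k j + i : ℕ) : ℝ) - k j = i := by push_cast; ring
  rw [hNi] at hN0 ⊢
  have hmain := hω2 i
  have hlog1 : (2 : ℝ) / (δ / h j / 2) = 4 / (δ / h j) := by
    rw [div_div_eq_mul_div]; norm_num
  have hlog2 : 4 * h j / δ = 4 / (δ / h j) := by rw [div_div_eq_mul_div]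
  rw [hlog1] at hmain
  rw [hlog2]
  have hdet := s17_det (p := p) (b := β * Real.log (4 / (δ / h j))) (A := A)
    (V := v + (R j) ^ p) (T := (2 : ℝ) ^ j) (N := (i : ℝ)) (lam := lam j) hp1
    (mul_pos hβ0 (hL j hj1)) hA (hV j) (by positivity) hN0 (by linarith) (by linarith) rfl
  refine le_trans ?_ hdet
  have hcen : ((i : ℝ))⁻¹ • (∑ m ∈ Finset.Ioc (k j) (k j + i),
            (truncB (lam j • (X m ω - Z j ω)) • (X m ω - Z j ω) + Z j ω)) - μ =
      ((i : ℝ))⁻¹ • (∑ m ∈ Finset.Ioc (k j) (k j + i),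
            (truncB (lam j • (X m ω - Z j ω)) • (X m ω - Z j ω) + Z j ω - μ)) := by
    rw [Finset.sum_sub_distrib, smul_sub, Finset.sum_const, Nat.card_Ioc, Nat.add_sub_cancel_left,
      ← Nat.cast_smul_eq_nsmul ℝ, smul_smul, inv_mul_cancel₀ hN0.ne', one_smul]
  rw [hcen, norm_smul, norm_inv, Real.norm_of_nonneg hN0.le]
  calc _ ≤ (i : ℝ)⁻¹ * ((i : ℝ) * (lam j ^ (p - 1) * A * (v + R j ^ p)) +
        β * Real.log (4 / (δ / h j)) / lam j) := by gcongr
    _ = _ := by field_simp
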